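/- arXiv:1206.1352 — 9 statements merged into one kernel-verified Lean document; each statement's English description precedes it below -/
import Mathlib

section
/- Assume ab > 4 and let ζ > 1 be a real root of the polynomial X⁴ − (ab−2)X² + 1. Then for every n ≥ 1: if n is odd, c_n = (ζ^{2n} − 1)/(ζ^{n−1}(ζ² − 1)); and if n is even, c_n = b(ζ^{2n} − 1)/(ζ^{n−2}(ζ⁴ − 1)), where c_n is viewed as a real number via the inclusion ℤ ⊆ ℝ. -/
/-- Closed form, with denominators cleared, for a linear recurrence whose characteristic
polynomial has the roots `x` and `x⁻¹`. -/
theorem mul_pow_eq_of_reciprocal_recurrence {R : Type*} [CommRing R] (u : ℕ → R) (x w p q : R)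
    (h0 : u 0 * w = p - q) (h1 : u 1 * x * w = p * x ^ 2 - q)
    (hu : ∀ k, x * u (k + 2) = (x ^ 2 + 1) * u (k + 1) - x * u k) (k : ℕ) :
    u k * x ^ k * w = p * x ^ (2 * k) - q := by
  induction k using Nat.twoStepInduction with
  | zero => simpa using h0
  | one => simpa using h1
  | more k ih₀ ih₁ =>
    linear_combination x ^ (k + 1) * w * hu k + (x ^ 2 + 1) * ih₁ - x ^ 2 * ih₀

/-- Eliminating the auxiliary sequence from the coupled recursions. -/
theorem add_four_eq_of_coupled_recurrence {R : Type*} [CommRing R] {a b : R} {c d : ℕ → R}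
    (hc : ∀ n, c (n + 2) = b * d (n + 1) - c n) (hd : ∀ n, d (n + 2) = a * c (n + 1) - d n)
    (n : ℕ) : c (n + 4) = (a * b - 2) * c (n + 2) - c n := by
  linear_combination hc (n + 2) + b * hd (n + 1) + hc n

theorem stmt2 (a b : ℤ) (ha : 0 < a) (hab : a ≤ b) (hab4 : 4 ≤ a * b)
    (c d : ℕ → ℤ)
    (hc0 : c 0 = 0) (hd0 : d 0 = 0) (hc1 : c 1 = 1) (hd1 : d 1 = 1)
    (hcrec : ∀ n : ℕ, c (n + 2) = b * d (n + 1) - c n)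
    (hdrec : ∀ n : ℕ, d (n + 2) = a * c (n + 1) - d n)
    (hab4' : 4 < a * b) (ζ : ℝ) (hζ : 1 < ζ)
    (hroot : ζ ^ 4 - ((a * b - 2 : ℤ) : ℝ) * ζ ^ 2 + 1 = 0) :
    ∀ n : ℕ, 1 ≤ n →
      (Odd n → (c n : ℝ) = (ζ ^ (2 * n) - 1) / (ζ ^ (n - 1) * (ζ ^ 2 - 1))) ∧
      (Even n → (c n : ℝ) = (b : ℝ) * (ζ ^ (2 * n) - 1) / (ζ ^ (n - 2) * (ζ ^ 4 - 1))) := by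
  have hrec (n : ℕ) : ζ ^ 2 * (c (n + 4) : ℝ) =
      ((ζ ^ 2) ^ 2 + 1) * c (n + 2) - ζ ^ 2 * c n := by
    rw [add_four_eq_of_coupled_recurrence hcrec hdrec n]
    push_cast at hroot ⊢
    linear_combination -(c (n + 2) : ℝ) * hroot
  have hc2 : c 2 = b := by simpa [hc0, hd1] using hcrec 0
  have hc3 : c 3 = a * b - 1 := by
    linear_combination hcrec 1 + b * hdrec 0 + a * b * hc1 - hc1 - b * hd0
  have hc4 : c 4 = (a * b - 2) * b := by
    simpa [hc0, hc2] using add_four_eq_of_coupled_recurrence hcrec hdrec 0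
  have hζ0 : 0 < ζ := by linarith
  have hsq : 0 < ζ ^ 2 - 1 := sub_pos.2 (one_lt_pow₀ hζ (by norm_num))
  have hfourth : 0 < ζ ^ 4 - 1 := sub_pos.2 (one_lt_pow₀ hζ (by norm_num))
  push_cast at hroot
  intro n hn
  constructor
  · rintro ⟨k, rfl⟩
    have key := mul_pow_eq_of_reciprocal_recurrence (fun k ↦ (c (2 * k + 1) : ℝ))
      (ζ ^ 2) (ζ ^ 2 - 1) (ζ ^ 2) 1 (by simp [hc1])
      (by
        simp only [mul_one, Nat.reduceAdd, hc3]
        push_cast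
        linear_combination -(ζ ^ 2 - 1) * hroot)
      (fun k ↦ hrec (2 * k + 1)) k
    rw [eq_div_iff (by positivity), Nat.add_sub_cancel]
    linear_combination key
  · rintro ⟨m, rfl⟩
    obtain ⟨k, rfl⟩ : ∃ k, m = k + 1 := ⟨m - 1, by lia⟩
    have key := mul_pow_eq_of_reciprocal_recurrence (fun k ↦ (c (2 * k + 2) : ℝ))
      (ζ ^ 2) (ζ ^ 4 - 1) (b * ζ ^ 4) b (by simp [hc2]; ring)
      (by
        simp only [mul_one, Nat.reduceAdd, hc4]
        push_cast
        linear_combination -(b : ℝ) * (ζ ^ 4 - 1) * hroot)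
      (fun k ↦ hrec (2 * k + 2)) k
    rw [show k + 1 + (k + 1) = 2 * k + 2 by ring, eq_div_iff (by positivity), Nat.add_sub_cancel]
    linear_combination key
end

section
/- Assume ab > 4. Then the function f(n) = c_{2n+1} − c_{2n−1}, defined for n > 0, is strictly increasing: for all n, n' with 0 < n < n' one has c_{2n+1} − c_{2n−1} < c_{2n'+1} − c_{2n'−1}. -/
/-- Two steps of the coupled recursion give a three-term recursion within each parity class. -/
theorem three_term_recursion {a b : ℤ} {c d : ℕ → ℤ}
    (hcrec : ∀ n : ℕ, c (n + 2) = b * d (n + 1) - c n)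
    (hdrec : ∀ n : ℕ, d (n + 2) = a * c (n + 1) - d n) (n : ℕ) :
    c (n + 4) = (a * b - 2) * c (n + 2) - c n := by
  linear_combination hcrec (n + 2) + b * hdrec (n + 1) + hcrec n

/-- A sequence with `x (k + 2) = (t - 2) * x (k + 1) - x k`, `4 ≤ t` and `0 < x 0 < x 1` is
positive and strictly increasing. -/
theorem pos_and_lt_succ_of_recursion {t : ℤ} (ht : 4 ≤ t) {x : ℕ → ℤ} (h0 : 0 < x 0)
    (h01 : x 0 < x 1) (hx : ∀ k, x (k + 2) = (t - 2) * x (k + 1) - x k) (k : ℕ) :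
    0 < x k ∧ x k < x (k + 1) := by
  induction k with
  | zero => exact ⟨h0, h01⟩
  | succ k ih =>
    have hpos : 0 < x (k + 1) := ih.1.trans ih.2
    refine ⟨hpos, ?_⟩
    nlinarith [hx k, mul_nonneg (sub_nonneg.2 ht) hpos.le, ih.2]

/-- If moreover `4 < t`, then the differences of the sequence are strictly increasing. -/
theorem strictMono_sub_of_recursion {t : ℤ} (ht : 4 < t) {x : ℕ → ℤ} (h0 : 0 < x 0)
    (h01 : x 0 < x 1) (hx : ∀ k, x (k + 2) = (t - 2) * x (k + 1) - x k) :
    StrictMono fun k => x (k + 1) - x k := by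
  refine strictMono_nat_of_lt_succ fun k => ?_
  have hpos := (pos_and_lt_succ_of_recursion ht.le h0 h01 hx (k + 1)).1
  change x (k + 1) - x k < x (k + 2) - x (k + 1)
  nlinarith [hx k, mul_pos (sub_pos.2 ht) hpos]

theorem stmt4 (a b : ℤ) (ha : 0 < a) (hab : a ≤ b) (hab4 : 4 ≤ a * b)
    (c d : ℕ → ℤ)
    (hc0 : c 0 = 0) (hd0 : d 0 = 0) (hc1 : c 1 = 1) (hd1 : d 1 = 1)
    (hcrec : ∀ n : ℕ, c (n + 2) = b * d (n + 1) - c n)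
    (hdrec : ∀ n : ℕ, d (n + 2) = a * c (n + 1) - d n)
    (hab4' : 4 < a * b) :
    ∀ n n' : ℕ, 0 < n → n < n' →
      c (2 * n + 1) - c (2 * n - 1) < c (2 * n' + 1) - c (2 * n' - 1) := by
  intro n n' hn hnn'
  obtain ⟨k, rfl⟩ := Nat.exists_eq_add_of_lt hn
  obtain ⟨l, rfl⟩ := Nat.exists_eq_add_of_lt hnn'
  have hc3 : c 3 = a * b - 1 := by
    linear_combination hcrec 1 + b * hdrec 0 + (a * b - 1) * hc1 - b * hd0
  have hmono := strictMono_sub_of_recursion hab4' (x := fun k => c (2 * k + 1))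
    (by simp [hc1]) (by simp only [mul_zero, mul_one, zero_add, hc1, Nat.reduceAdd, hc3]; linarith)
    fun k => three_term_recursion hcrec hdrec (2 * k + 1)
  have hidx (m : ℕ) : 2 * (m + 1) - 1 = 2 * m + 1 := by omega
  have hlt := hmono (show k < k + l + 1 by omega)
  simpa only [zero_add, hidx, add_right_comm k 1 l] using hlt
end

section
/- If (a,b) ≠ (1,4), then for all n ≥ 0 one has d_{2n} < d_{2n+1} and d_{2n+1} < d_{2n+4}. -/
theorem exists_chebyshev_pair (a b : ℤ) (ha : 0 < a) (hab : a ≤ b) (hab4 : 4 ≤ a * b)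
    (c d : ℕ → ℤ)
    (hc0 : c 0 = 0) (hd0 : d 0 = 0) (hc1 : c 1 = 1) (hd1 : d 1 = 1)
    (hcrec : ∀ n : ℕ, c (n + 2) = b * d (n + 1) - c n)
    (hdrec : ∀ n : ℕ, d (n + 2) = a * c (n + 1) - d n) (n : ℕ) :
    ∃ x y : ℤ, 0 ≤ x ∧ x < y ∧ (a - 1) * x < y ∧ c (2 * n) = b * x ∧ d (2 * n) = a * x ∧
      c (2 * n + 1) = x + y ∧ d (2 * n + 1) = x + y := by
  induction n with
  | zero => exact ⟨0, 1, by simp [hc0, hd0, hc1, hd1]⟩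
  | succ n ih =>
    obtain ⟨x, y, hx, hxy, -, hc, hd, hc', hd'⟩ := ih
    have hy : 0 < y := hx.trans_lt hxy
    have hc2 : c (2 * n + 2) = b * y := by rw [hcrec, hd', hc]; ring
    have hd2 : d (2 * n + 2) = a * y := by rw [hdrec, hc', hd]; ring
    have hab2 : a + 2 ≤ a * b := by
      by_cases h : a = 1
      · linarith
      · have : 2 ≤ a := by omega
        nlinarith
    refine ⟨y, (a * b - 2) * y - x, hy.le, by nlinarith, by nlinarith, hc2, hd2, ?_, ?_⟩
    · rw [show 2 * (n + 1) + 1 = 2 * n + 1 + 2 by ring, hcrec, hd2, hc']; ring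
    · rw [show 2 * (n + 1) + 1 = 2 * n + 1 + 2 by ring, hdrec, hc2, hd']; ring

theorem stmt7 (a b : ℤ) (ha : 0 < a) (hab : a ≤ b) (hab4 : 4 ≤ a * b)
    (c d : ℕ → ℤ)
    (hc0 : c 0 = 0) (hd0 : d 0 = 0) (hc1 : c 1 = 1) (hd1 : d 1 = 1)
    (hcrec : ∀ n : ℕ, c (n + 2) = b * d (n + 1) - c n)
    (hdrec : ∀ n : ℕ, d (n + 2) = a * c (n + 1) - d n)
    (hne : ¬(a = 1 ∧ b = 4)) :
    ∀ n : ℕ, d (2 * n) < d (2 * n + 1) ∧ d (2 * n + 1) < d (2 * n + 4) := by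
  intro n
  obtain ⟨x, y, hx, hxy, hlt, hc, hd, hc', hd'⟩ :=
    exists_chebyshev_pair a b ha hab hab4 c d hc0 hd0 hc1 hd1 hcrec hdrec n
  have hy : 0 < y := hx.trans_lt hxy
  have hd4 : d (2 * n + 4) = a * ((a * b - 2) * y - x) := by
    rw [hdrec (2 * n + 2), hcrec (2 * n + 1), hdrec (2 * n), hc', hd]; ring
  refine ⟨by rw [hd, hd']; linarith, ?_⟩
  rw [hd', hd4]
  by_cases h : a = 1
  · subst h
    have hb : 5 ≤ b := by omega
    nlinarith
  · have ha2 : 2 ≤ a := by omega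
    have hz : y < (a * b - 2) * y - x := by nlinarith
    nlinarith
end

section
/- If a = 1 (so that b ≥ 4), then for every n > 1 one has d_{2n+1} < (b−1)·d_{2n} and d_{2n+1} < (b−2)·d_{2n−1}. -/
/-- For `a = 1`, the sequences satisfy `c = d` at odd indices and `c = b * d` at even indices, and
the values of `d` at odd indices are positive and at most twice the following value. -/
theorem odd_even_invariant {b : ℤ} (hb : 4 ≤ b) {c d : ℕ → ℤ}
    (hc0 : c 0 = 0) (hd0 : d 0 = 0) (hc1 : c 1 = 1) (hd1 : d 1 = 1)
    (hcrec : ∀ n : ℕ, c (n + 2) = b * d (n + 1) - c n)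
    (hdrec : ∀ n : ℕ, d (n + 2) = c (n + 1) - d n) (n : ℕ) :
    c (2 * n + 1) = d (2 * n + 1) ∧ c (2 * n + 2) = b * d (2 * n + 2) ∧
      0 < d (2 * n + 1) ∧ d (2 * n + 1) ≤ 2 * d (2 * n + 2) := by
  induction n with
  | zero => simp [hcrec 0, hdrec 0, hc0, hd0, hc1, hd1]
  | succ n ih =>
    obtain ⟨hodd, heven, hpos, hle⟩ := ih
    have hc3 : c (2 * n + 3) = _ := hcrec (2 * n + 1)
    have hd3 : d (2 * n + 3) = _ := hdrec (2 * n + 1)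
    have hc4 : c (2 * n + 4) = _ := hcrec (2 * n + 2)
    have hd4 : d (2 * n + 4) = _ := hdrec (2 * n + 2)
    simp only [Nat.add_assoc, Nat.reduceAdd] at hc3 hd3 hc4 hd4
    have hy : 0 < d (2 * n + 2) := by linarith
    have hby : 4 * d (2 * n + 2) ≤ b * d (2 * n + 2) := by gcongr
    rw [show 2 * (n + 1) + 1 = 2 * n + 3 by ring, show 2 * (n + 1) + 2 = 2 * n + 4 by ring]
    refine ⟨by rw [hc3, hd3, hodd, heven], ?_, by linarith, by linarith⟩
    rw [hc4, hd4, hc3, heven, hodd, hd3, heven]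
    ring

theorem stmt8 (a b : ℤ) (ha : 0 < a) (hab : a ≤ b) (hab4 : 4 ≤ a * b)
    (c d : ℕ → ℤ)
    (hc0 : c 0 = 0) (hd0 : d 0 = 0) (hc1 : c 1 = 1) (hd1 : d 1 = 1)
    (hcrec : ∀ n : ℕ, c (n + 2) = b * d (n + 1) - c n)
    (hdrec : ∀ n : ℕ, d (n + 2) = a * c (n + 1) - d n)
    (ha1 : a = 1) :
    ∀ n : ℕ, 1 < n →
      d (2 * n + 1) < (b - 1) * d (2 * n) ∧ d (2 * n + 1) < (b - 2) * d (2 * n - 1) := by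
  intro n hn
  subst ha1
  simp only [one_mul] at hab4 hdrec
  obtain ⟨m, rfl⟩ := Nat.exists_eq_add_of_le' hn
  have inv := odd_even_invariant hab4 hc0 hd0 hc1 hd1 hcrec hdrec
  obtain ⟨hodd, heven, hpos, -⟩ := inv m
  obtain ⟨hodd', heven', hpos', -⟩ := inv (m + 1)
  rw [show 2 * (m + 1) + 1 = 2 * m + 3 by ring] at hodd' hpos'
  rw [show 2 * (m + 1) + 2 = 2 * m + 4 by ring] at heven'
  have hd3 : d (2 * m + 3) = c (2 * m + 2) - d (2 * m + 1) := hdrec (2 * m + 1)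
  have hd4 : d (2 * m + 4) = c (2 * m + 3) - d (2 * m + 2) := hdrec (2 * m + 2)
  have hd5 : d (2 * m + 5) = c (2 * m + 4) - d (2 * m + 3) := hdrec (2 * m + 3)
  rw [show 2 * (m + (1 + 1)) + 1 = 2 * m + 5 by ring,
    show 2 * (m + (1 + 1)) - 1 = 2 * m + 3 by lia, show 2 * (m + (1 + 1)) = 2 * m + 4 by ring]
  have hy : 0 < d (2 * m + 2) := by nlinarith
  rw [hodd'] at hd4
  rw [heven] at hd3
  rw [heven'] at hd5
  have hlin : b * d (2 * m + 4) = b * d (2 * m + 3) - b * d (2 * m + 2) := by rw [hd4]; ring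
  constructor <;> linarith
end

section
/- If e and w both lie in 𝒜 (respectively, both lie in ℬ), then the pair {e, w} is pre-nilpotent: there exist matrices ω, ω' in W such that ω·e and ω·w both lie in Φ⁺ and ω'·e and ω'·w both lie in −Φ⁺. -/
/-- If `g₁` and `g₂` act on two chains `p`, `q` of vectors as the generators of an infinite dihedral
group, then any initial segment of `p` is sent to negative vectors by an element of the group which
keeps all of `q` positive, and the same holds with the roles of `p` and `q` exchanged. -/
theorem exists_mem_mulVec_neg_of_chains {n K : Type*} [Fintype n] [DecidableEq n] [Field K]
    {W : Subgroup (Matrix.GeneralLinearGroup n K)} {g₁ g₂ : Matrix.GeneralLinearGroup n K}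
    (hg₁ : g₁ ∈ W) (hg₂ : g₂ ∈ W) {p q : ℕ → n → K} {S : Set (n → K)}
    (hpS : ∀ k, p k ∈ S) (hqS : ∀ k, q k ∈ S)
    (hp0 : g₁.val.mulVec (p 0) = -p 0) (hp : ∀ k, g₁.val.mulVec (p (k + 1)) = q k)
    (hq : ∀ k, g₁.val.mulVec (q k) = p (k + 1))
    (hq0 : g₂.val.mulVec (q 0) = -q 0) (hq' : ∀ k, g₂.val.mulVec (q (k + 1)) = p k)
    (hp' : ∀ k, g₂.val.mulVec (p k) = q (k + 1)) (N : ℕ) :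
    (∃ ω ∈ W, (∀ j ≤ N, -(ω.val.mulVec (p j)) ∈ S) ∧ ∀ k, ω.val.mulVec (q k) ∈ S) ∧
    (∃ ω ∈ W, (∀ j ≤ N, -(ω.val.mulVec (q j)) ∈ S) ∧ ∀ k, ω.val.mulVec (p k) ∈ S) := by
  induction N with
  | zero =>
    refine ⟨⟨g₁, hg₁, fun j hj => ?_, fun k => ?_⟩, ⟨g₂, hg₂, fun j hj => ?_, fun k => ?_⟩⟩
    · obtain rfl := Nat.le_zero.mp hj
      rw [hp0, neg_neg]
      exact hpS 0
    · rw [hq]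
      exact hpS _
    · obtain rfl := Nat.le_zero.mp hj
      rw [hq0, neg_neg]
      exact hqS 0
    · rw [hp']
      exact hqS _
  | succ N ih =>
    obtain ⟨⟨ω, hω, hωp, hωq⟩, ⟨ω', hω', hωq', hωp'⟩⟩ := ih
    refine ⟨⟨ω' * g₁, W.mul_mem hω' hg₁, fun j hj => ?_, fun k => ?_⟩,
      ⟨ω * g₂, W.mul_mem hω hg₂, fun j hj => ?_, fun k => ?_⟩⟩ <;>
      rw [Units.val_mul, ← Matrix.mulVec_mulVec]
    · cases j with
      | zero =>
        rw [hp0, Matrix.mulVec_neg, neg_neg]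
        exact hωp' 0
      | succ j =>
        rw [hp]
        exact hωq' j (Nat.le_of_succ_le_succ hj)
    · rw [hq]
      exact hωp' _
    · cases j with
      | zero =>
        rw [hq0, Matrix.mulVec_neg, neg_neg]
        exact hωq 0
      | succ j =>
        rw [hq']
        exact hωp j (Nat.le_of_succ_le_succ hj)
    · rw [hp']
      exact hωq _

theorem stmt9 (a b : ℤ) (ha : 0 < a) (hab : a ≤ b) (hab4 : 4 ≤ a * b)
    (c d : ℕ → ℤ)
    (hc0 : c 0 = 0) (hd0 : d 0 = 0) (hc1 : c 1 = 1) (hd1 : d 1 = 1)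
    (hcrec : ∀ n : ℕ, c (n + 2) = b * d (n + 1) - c n)
    (hdrec : ∀ n : ℕ, d (n + 2) = a * c (n + 1) - d n)
    (u v ub vb : ℕ → (Fin 2 → ℚ))
    (hu : ∀ i, u i = ![(d (2 * i + 1) : ℚ), (c (2 * i) : ℚ)])
    (hv : ∀ i, v i = ![(d (2 * i) : ℚ), (c (2 * i + 1) : ℚ)])
    (hub : ∀ i, ub i = ![(d (2 * i + 2) : ℚ), (c (2 * i + 1) : ℚ)])
    (hvb : ∀ i, vb i = ![(d (2 * i + 1) : ℚ), (c (2 * i + 2) : ℚ)])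
    (A B Pos : Set (Fin 2 → ℚ))
    (hA : A = {x | ∃ i, x = u i ∨ x = ub i})
    (hB : B = {x | ∃ i, x = v i ∨ x = vb i})
    (hPos : Pos = A ∪ B)
    (w1 w2 : Matrix.GeneralLinearGroup (Fin 2) ℚ)
    (hw1 : (w1 : Matrix (Fin 2) (Fin 2) ℚ) = !![-1, (a : ℚ); 0, 1])
    (hw2 : (w2 : Matrix (Fin 2) (Fin 2) ℚ) = !![1, 0; (b : ℚ), -1])
    (W : Subgroup (Matrix.GeneralLinearGroup (Fin 2) ℚ))
    (hW : W = Subgroup.closure {w1, w2})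
    (e w : Fin 2 → ℚ)
    (h : (e ∈ A ∧ w ∈ A) ∨ (e ∈ B ∧ w ∈ B)) :
    (∃ ω ∈ W, (ω : Matrix (Fin 2) (Fin 2) ℚ).mulVec e ∈ Pos ∧
      (ω : Matrix (Fin 2) (Fin 2) ℚ).mulVec w ∈ Pos) ∧
    (∃ ω' ∈ W, -((ω' : Matrix (Fin 2) (Fin 2) ℚ).mulVec e) ∈ Pos ∧
      -((ω' : Matrix (Fin 2) (Fin 2) ℚ).mulVec w) ∈ Pos) := by
  have hePos : e ∈ Pos ∧ w ∈ Pos := by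
    rw [hPos]
    exact h.elim (fun h => ⟨Or.inl h.1, Or.inl h.2⟩) (fun h => ⟨Or.inr h.1, Or.inr h.2⟩)
  refine ⟨⟨1, W.one_mem, by simpa using hePos⟩, ?_⟩
  let p : ℕ → Fin 2 → ℚ := fun k => ![(d (k + 1) : ℚ), (c k : ℚ)]
  let q : ℕ → Fin 2 → ℚ := fun k => ![(d k : ℚ), (c (k + 1) : ℚ)]
  have hpA (k : ℕ) : p k ∈ A := by
    rw [hA]
    obtain ⟨i, rfl | rfl⟩ := Nat.even_or_odd' k
    · exact ⟨i, Or.inl (hu i).symm⟩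
    · exact ⟨i, Or.inr (hub i).symm⟩
  have hqB (k : ℕ) : q k ∈ B := by
    rw [hB]
    obtain ⟨i, rfl | rfl⟩ := Nat.even_or_odd' k
    · exact ⟨i, Or.inl (hv i).symm⟩
    · exact ⟨i, Or.inr (hvb i).symm⟩
  have hAp {x : Fin 2 → ℚ} (hx : x ∈ A) : ∃ k, x = p k := by
    rw [hA] at hx
    obtain ⟨i, rfl | rfl⟩ := hx
    · exact ⟨2 * i, hu i⟩
    · exact ⟨2 * i + 1, hub i⟩
  have hBq {x : Fin 2 → ℚ} (hx : x ∈ B) : ∃ k, x = q k := by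
    rw [hB] at hx
    obtain ⟨i, rfl | rfl⟩ := hx
    · exact ⟨2 * i, hv i⟩
    · exact ⟨2 * i + 1, hvb i⟩
  have key := exists_mem_mulVec_neg_of_chains (W := W) (g₁ := w1) (g₂ := w2) (p := p) (q := q)
    (S := Pos) (hW ▸ Subgroup.subset_closure (by simp)) (hW ▸ Subgroup.subset_closure (by simp))
    (fun k => hPos ▸ Or.inl (hpA k)) (fun k => hPos ▸ Or.inr (hqB k))
    (by ext i; fin_cases i <;> simp [hw1, p, Matrix.mulVec, dotProduct, Fin.sum_univ_two, hc0])
    (fun k => by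
      ext i; fin_cases i <;>
        simp [hw1, p, q, Matrix.mulVec, dotProduct, Fin.sum_univ_two, hdrec])
    (fun k => by
      ext i; fin_cases i <;>
        simp [hw1, p, q, Matrix.mulVec, dotProduct, Fin.sum_univ_two, hdrec] <;> ring)
    (by ext i; fin_cases i <;> simp [hw2, q, Matrix.mulVec, dotProduct, Fin.sum_univ_two, hd0])
    (fun k => by
      ext i; fin_cases i <;>
        simp [hw2, p, q, Matrix.mulVec, dotProduct, Fin.sum_univ_two, hcrec])
    (fun k => by
      ext i; fin_cases i <;>
        simp [hw2, p, q, Matrix.mulVec, dotProduct, Fin.sum_univ_two, hcrec] <;> ring)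
  obtain ⟨he, hw⟩ | ⟨he, hw⟩ := h
  · obtain ⟨i, rfl⟩ := hAp he
    obtain ⟨j, rfl⟩ := hAp hw
    obtain ⟨ω, hω, hneg, -⟩ := (key (max i j)).1
    exact ⟨ω, hω, hneg i (le_max_left i j), hneg j (le_max_right i j)⟩
  · obtain ⟨i, rfl⟩ := hBq he
    obtain ⟨j, rfl⟩ := hBq hw
    obtain ⟨ω, hω, hneg, -⟩ := (key (max i j)).2
    exact ⟨ω, hω, hneg i (le_max_left i j), hneg j (le_max_right i j)⟩
end

section
/- If a > 1 and e and w both lie in 𝒜 (respectively, both lie in ℬ), then e + w ∉ Φ. -/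
/-- The quadratic form `b x² - ab xy + a y²` preserved by the simple reflections of the rank-two
root system with Cartan integers `-a`, `-b`. -/
def rootForm (a b : ℤ) (z : ℤ × ℤ) : ℤ :=
  b * z.1 ^ 2 - a * b * (z.1 * z.2) + a * z.2 ^ 2

theorem rootForm_neg (a b : ℤ) (z : ℤ × ℤ) : rootForm a b (-z) = rootForm a b z := by
  simp only [rootForm, Prod.fst_neg, Prod.snd_neg]
  ring

theorem rootForm_swap (a b x y : ℤ) : rootForm a b (x, y) = rootForm b a (y, x) := by
  simp only [rootForm]
  ring

theorem rootForm_reflect_fst (a b x y : ℤ) :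
    rootForm a b (a * y - x, y) = rootForm a b (x, y) := by
  simp only [rootForm]
  ring

theorem rootForm_reflect_snd (a b x y : ℤ) :
    rootForm a b (x, b * x - y) = rootForm a b (x, y) := by
  simp only [rootForm]
  ring

/-- The form is strictly superadditive on the component of its positive cone containing the
positive first axis. -/
theorem rootForm_add_lt {a b : ℤ} (ha : 0 < a) (hb : 0 < b) (hab : 4 ≤ a * b)
    {x y x' y' : ℤ}
    (hx : a * y < 2 * x) (hx' : a * y' < 2 * x')
    (hq : 0 < rootForm a b (x, y)) (hq' : 0 < rootForm a b (x', y')) :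
    rootForm a b (x, y) + rootForm a b (x', y') < rootForm a b (x + x', y + y') := by
  simp only [rootForm] at *
  have hD : 0 ≤ a * b * (a * b - 4) := mul_nonneg (mul_pos ha hb).le (by linarith)
  have hX : 0 < b * (2 * x - a * y) := mul_pos hb (by linarith)
  have hX' : 0 < b * (2 * x' - a * y') := mul_pos hb (by linarith)
  have h1 : a * b * (a * b - 4) * y ^ 2 < (b * (2 * x - a * y)) ^ 2 := by
    nlinarith [mul_pos hb hq]
  have h2 : a * b * (a * b - 4) * y' ^ 2 < (b * (2 * x' - a * y')) ^ 2 := by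
    nlinarith [mul_pos hb hq']
  have h3 : a * b * (a * b - 4) * (y * y') <
      (b * (2 * x - a * y)) * (b * (2 * x' - a * y')) := by
    refine lt_of_pow_lt_pow_left₀ 2 (mul_pos hX hX').le ?_
    have := mul_lt_mul'' h1 h2 (mul_nonneg hD (sq_nonneg y)) (mul_nonneg hD (sq_nonneg y'))
    linarith
  have h4 : 0 < b * (2 * b * x * x' - a * b * (x * y' + x' * y) + 2 * a * y * y') := by
    linarith
  have h5 := pos_of_mul_pos_right h4 hb.le
  linarith

/-- A vector with the norm and the divisibility property of a real root: short roots have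
norm `a` and first coordinate divisible by `a`, long roots have norm `b` and first coordinate
not divisible by `a`. -/
def IsShortOrLong (a b : ℤ) (z : ℤ × ℤ) : Prop :=
  (rootForm a b z = a ∧ a ∣ z.1) ∨ (rootForm a b z = b ∧ ¬ a ∣ z.1)

theorem IsShortOrLong.of_neg {a b : ℤ} {z : ℤ × ℤ} (h : IsShortOrLong a b (-z)) :
    IsShortOrLong a b z := by
  simpa only [IsShortOrLong, rootForm_neg, Prod.fst_neg, dvd_neg] using h

theorem IsShortOrLong.rootForm_pos {a b : ℤ} (ha : 0 < a) (hab : a ≤ b) {z : ℤ × ℤ}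
    (h : IsShortOrLong a b z) : 0 < rootForm a b z := by
  rcases h with ⟨h, -⟩ | ⟨h, -⟩ <;> linarith

theorem not_isShortOrLong_add {a b : ℤ} (ha : 0 < a) (hab : a ≤ b) {e w : ℤ × ℤ}
    (he : IsShortOrLong a b e) (hw : IsShortOrLong a b w)
    (hlt : rootForm a b e + rootForm a b w < rootForm a b (e + w)) :
    ¬ IsShortOrLong a b (e + w) := by
  rintro (⟨h, -⟩ | ⟨h, hn⟩) <;> rcases he with ⟨he, hde⟩ | ⟨he, -⟩ <;>
    rcases hw with ⟨hw, hdw⟩ | ⟨hw, -⟩ <;> first | linarith | exact hn (dvd_add hde hdw)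

section Recursion

variable {a b : ℤ} {c d : ℕ → ℤ}

theorem recursion_bounds (ha : 0 < a) (hb : 0 < b) (hab : 4 ≤ a * b)
    (hc0 : c 0 = 0) (hd0 : d 0 = 0) (hc1 : c 1 = 1) (hd1 : d 1 = 1)
    (hcrec : ∀ n : ℕ, c (n + 2) = b * d (n + 1) - c n)
    (hdrec : ∀ n : ℕ, d (n + 2) = a * c (n + 1) - d n) (n : ℕ) :
    0 ≤ c n ∧ 0 ≤ d n ∧ a * c n < 2 * d (n + 1) ∧ b * d n < 2 * c (n + 1) := by
  induction n with
  | zero => simp [hc0, hd0, hc1, hd1]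
  | succ n ih =>
    obtain ⟨hc, hd, h1, h2⟩ := ih
    have := mul_nonneg ha.le hc
    have := mul_nonneg hb.le hd
    refine ⟨by linarith, by linarith, ?_, ?_⟩
    · rw [hdrec]
      nlinarith [mul_lt_mul_of_pos_left h2 ha, mul_le_mul_of_nonneg_right hab hd]
    · rw [hcrec]
      nlinarith [mul_lt_mul_of_pos_left h1 hb, mul_le_mul_of_nonneg_right hab hc]

theorem dvd_recursion (ha : 1 < a) (hd0 : d 0 = 0) (hd1 : d 1 = 1)
    (hdrec : ∀ n : ℕ, d (n + 2) = a * c (n + 1) - d n) (i : ℕ) :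
    a ∣ d (2 * i) ∧ ¬ a ∣ d (2 * i + 1) := by
  induction i with
  | zero =>
    refine ⟨by simp [hd0], fun h => ?_⟩
    have := Int.le_of_dvd one_pos (by simpa [hd1] using h)
    linarith
  | succ i ih =>
    rw [show 2 * (i + 1) = 2 * i + 2 by ring, show 2 * i + 2 + 1 = 2 * i + 1 + 2 by ring,
      hdrec, hdrec, dvd_sub_right (dvd_mul_right a _), dvd_sub_right (dvd_mul_right a _)]
    exact ih

theorem rootForm_recursion_succ (hcrec : ∀ n : ℕ, c (n + 2) = b * d (n + 1) - c n)
    (hdrec : ∀ n : ℕ, d (n + 2) = a * c (n + 1) - d n) (n : ℕ) :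
    rootForm a b (d (n + 2), c (n + 1)) = rootForm a b (d n, c (n + 1)) ∧
      rootForm a b (d (n + 1), c (n + 2)) = rootForm a b (d (n + 1), c n) := by
  rw [hcrec, hdrec, rootForm_reflect_fst, rootForm_reflect_snd]
  exact ⟨rfl, rfl⟩

theorem rootForm_recursion (hc0 : c 0 = 0) (hd0 : d 0 = 0) (hc1 : c 1 = 1) (hd1 : d 1 = 1)
    (hcrec : ∀ n : ℕ, c (n + 2) = b * d (n + 1) - c n)
    (hdrec : ∀ n : ℕ, d (n + 2) = a * c (n + 1) - d n) (i : ℕ) :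
    rootForm a b (d (2 * i + 1), c (2 * i)) = b ∧
      rootForm a b (d (2 * i), c (2 * i + 1)) = a := by
  induction i with
  | zero => simp [rootForm, hc0, hd0, hc1, hd1]
  | succ i ih =>
    obtain ⟨h1, h2⟩ := rootForm_recursion_succ hcrec hdrec (2 * i)
    obtain ⟨h3, h4⟩ := rootForm_recursion_succ hcrec hdrec (2 * i + 1)
    exact ⟨h3.trans (h2.trans ih.1), h4.trans (h1.trans ih.2)⟩

theorem isShortOrLong_recursion (ha : 1 < a)
    (hc0 : c 0 = 0) (hd0 : d 0 = 0) (hc1 : c 1 = 1) (hd1 : d 1 = 1)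
    (hcrec : ∀ n : ℕ, c (n + 2) = b * d (n + 1) - c n)
    (hdrec : ∀ n : ℕ, d (n + 2) = a * c (n + 1) - d n) (n : ℕ) :
    IsShortOrLong a b (d (n + 1), c n) ∧ IsShortOrLong a b (d n, c (n + 1)) := by
  have hq := rootForm_recursion hc0 hd0 hc1 hd1 hcrec hdrec
  have hdvd := dvd_recursion ha hd0 hd1 hdrec
  obtain ⟨i, rfl | rfl⟩ := n.even_or_odd'
  · exact ⟨Or.inr ⟨(hq i).1, (hdvd i).2⟩, Or.inl ⟨(hq i).2, (hdvd i).1⟩⟩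
  · obtain ⟨h1, h2⟩ := rootForm_recursion_succ hcrec hdrec (2 * i)
    exact ⟨Or.inl ⟨h1.trans (hq i).2, (hdvd (i + 1)).1⟩,
      Or.inr ⟨h2.trans (hq i).1, (hdvd i).2⟩⟩

end Recursion


theorem stmt10 (a b : ℤ) (ha : 0 < a) (hab : a ≤ b) (hab4 : 4 ≤ a * b)
    (c d : ℕ → ℤ)
    (hc0 : c 0 = 0) (hd0 : d 0 = 0) (hc1 : c 1 = 1) (hd1 : d 1 = 1)
    (hcrec : ∀ n : ℕ, c (n + 2) = b * d (n + 1) - c n)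
    (hdrec : ∀ n : ℕ, d (n + 2) = a * c (n + 1) - d n)
    (u v ub vb : ℕ → ℤ × ℤ)
    (hu : ∀ i, u i = (d (2 * i + 1), c (2 * i)))
    (hv : ∀ i, v i = (d (2 * i), c (2 * i + 1)))
    (hub : ∀ i, ub i = (d (2 * i + 2), c (2 * i + 1)))
    (hvb : ∀ i, vb i = (d (2 * i + 1), c (2 * i + 2)))
    (A B Pos Phi : Set (ℤ × ℤ))
    (hA : A = {x | ∃ i, x = u i ∨ x = ub i})
    (hB : B = {x | ∃ i, x = v i ∨ x = vb i})
    (hPos : Pos = A ∪ B)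
    (hPhi : Phi = Pos ∪ {x | -x ∈ Pos})
    (ha1 : 1 < a) :
    ∀ e w : ℤ × ℤ, ((e ∈ A ∧ w ∈ A) ∨ (e ∈ B ∧ w ∈ B)) → e + w ∉ Phi := by
  have hb : 0 < b := ha.trans_le hab
  have hbd := recursion_bounds ha hb hab4 hc0 hd0 hc1 hd1 hcrec hdrec
  have hsl := isShortOrLong_recursion (b := b) ha1 hc0 hd0 hc1 hd1 hcrec hdrec
  have hA' : ∀ z ∈ A, ∃ n, z = (d (n + 1), c n) := by
    rw [hA]
    rintro z ⟨i, rfl | rfl⟩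
    · exact ⟨2 * i, hu i⟩
    · exact ⟨2 * i + 1, hub i⟩
  have hB' : ∀ z ∈ B, ∃ n, z = (d n, c (n + 1)) := by
    rw [hB]
    rintro z ⟨i, rfl | rfl⟩
    · exact ⟨2 * i, hv i⟩
    · exact ⟨2 * i + 1, hvb i⟩
  have hPos' : ∀ z ∈ Pos, IsShortOrLong a b z := by
    rw [hPos]
    rintro z (hz | hz)
    · obtain ⟨n, rfl⟩ := hA' z hz
      exact (hsl n).1
    · obtain ⟨n, rfl⟩ := hB' z hz
      exact (hsl n).2
  have hPhi' : ∀ z ∈ Phi, IsShortOrLong a b z := by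
    rw [hPhi]
    rintro z (hz | hz)
    · exact hPos' z hz
    · exact (hPos' (-z) hz).of_neg
  rintro e w (⟨he, hw⟩ | ⟨he, hw⟩) hew
  · obtain ⟨m, rfl⟩ := hA' e he
    obtain ⟨n, rfl⟩ := hA' w hw
    exact not_isShortOrLong_add ha hab (hsl m).1 (hsl n).1
      (rootForm_add_lt ha hb hab4 (hbd m).2.2.1 (hbd n).2.2.1
        ((hsl m).1.rootForm_pos ha hab) ((hsl n).1.rootForm_pos ha hab)) (hPhi' _ hew)
  · obtain ⟨m, rfl⟩ := hB' e he
    obtain ⟨n, rfl⟩ := hB' w hw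
    have hm := (hsl m).2.rootForm_pos ha hab
    have hn := (hsl n).2.rootForm_pos ha hab
    refine not_isShortOrLong_add ha hab (hsl m).2 (hsl n).2 ?_ (hPhi' _ hew)
    rw [Prod.mk_add_mk]
    rw [rootForm_swap] at hm hn
    rw [rootForm_swap, rootForm_swap a b (d n), rootForm_swap a b (d m + d n)]
    exact rootForm_add_lt hb ha (by linarith) (hbd m).2.2.2
      (hbd n).2.2.2 hm hn
end

section
/- Let K and M be groups and let N be a normal subgroup of K of finite index r. Consider the free product K ∗ M and the subgroup of K ∗ M generated by (the canonical images of) N and M. Then the normal closure of this subgroup in K ∗ M is isomorphic, as a group, to the free product N ∗ M ∗ ⋯ ∗ M of N with r copies of M (i.e., the coproduct of the family of groups consisting of N together with r copies of M). -/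
namespace Monoid.Coprod

open Function

variable {K M ι : Type*} [Group K] [Group M] (N : Subgroup K)

/-- The homomorphism `N ∗ (∗_ι M) →* K ∗ M` which is the inclusion on `N` and sends the `i`-th copy
of `m` to its conjugate `(t i)⁻¹ * m * t i`. -/
def conjLift (t : ι → K) :
    Monoid.Coprod N (Monoid.CoprodI fun _ : ι => M) →* Monoid.Coprod K M :=
  lift (inl.comp N.subtype)
    (Monoid.CoprodI.lift fun i => (MulAut.conj (inl (t i))⁻¹).toMonoidHom.comp inr)

@[simp]
theorem conjLift_inl (t : ι → K) (n : N) : conjLift (M := M) N t (inl n) = inl (n : K) := rfl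

@[simp]
theorem conjLift_inr_of (t : ι → K) (i : ι) (m : M) :
    conjLift N t (inr (Monoid.CoprodI.of (i := i) m)) = (inl (t i))⁻¹ * inr m * inl (t i) := by
  simp [conjLift]

/-- Induction on the free product of `N` with a family of copies of `M`. -/
theorem induction_on_inl_of {P : Type*} [Group P]
    {motive : Monoid.Coprod P (Monoid.CoprodI fun _ : ι => M) → Prop}
    (x : Monoid.Coprod P (Monoid.CoprodI fun _ : ι => M))
    (one : motive 1) (inl_mem : ∀ p, motive (inl p))
    (of_mem : ∀ i m, motive (inr (Monoid.CoprodI.of (i := i) m)))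
    (mul : ∀ x y, motive x → motive y → motive (x * y)) : motive x := by
  induction x using Monoid.Coprod.induction_on with
  | inl p => exact inl_mem p
  | inr y =>
    induction y using Monoid.CoprodI.induction_on with
    | one => simpa using one
    | of i m => exact of_mem i m
    | mul x y hx hy => simpa using mul _ _ hx hy
  | mul x y hx hy => exact mul x y hx hy

/-- The Schreier cocycle `(t (k q))⁻¹ * k * t q` of a transversal `t`. -/
def cocycle (t : K ⧸ N → K) (ht : ∀ q, (t q : K ⧸ N) = q) (k : K) (q : K ⧸ N) : N :=
  ⟨(t (k • q))⁻¹ * (k * t q), by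
    rw [← QuotientGroup.eq, ht]
    nth_rw 1 [← ht q]
    rfl⟩

/-- The action of `K ∗ M` on `(K ⧸ N) × (N ∗ (∗_ι M))` induced by a transversal. -/
def cosetAction (e : ι ≃ K ⧸ N) (t : K ⧸ N → K) (ht : ∀ q, (t q : K ⧸ N) = q) :
    Monoid.Coprod K M →*
      Function.End ((K ⧸ N) × Monoid.Coprod N (Monoid.CoprodI fun _ : ι => M)) :=
  lift
    { toFun := fun k p => (k • p.1, inl (cocycle N t ht k p.1) * p.2)
      map_one' := by
        funext p
        have h : cocycle N t ht 1 p.1 = 1 := by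
          ext
          simp [cocycle]
        simp [h, Function.End.one_def]
      map_mul' := fun k l => by
        funext p
        have h : cocycle N t ht (k * l) p.1 =
            cocycle N t ht k (l • p.1) * cocycle N t ht l p.1 := by
          ext
          simp [cocycle, mul_smul, mul_assoc]
        simp only [h, mul_smul, map_mul, mul_assoc]
        rfl }
    { toFun := fun m p => (p.1, inr (Monoid.CoprodI.of (i := e.symm p.1) m) * p.2)
      map_one' := by
        funext p
        simp [Function.End.one_def]
      map_mul' := fun k l => by
        funext p
        simp only [map_mul, mul_assoc]
        rfl }

theorem cosetAction_inl (e : ι ≃ K ⧸ N) (t : K ⧸ N → K) (ht : ∀ q, (t q : K ⧸ N) = q)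
    (k : K) (q : K ⧸ N) (f : Monoid.Coprod N (Monoid.CoprodI fun _ : ι => M)) :
    cosetAction N e t ht (inl k) (q, f) = (k • q, inl (cocycle N t ht k q) * f) := rfl

theorem cosetAction_inr (e : ι ≃ K ⧸ N) (t : K ⧸ N → K) (ht : ∀ q, (t q : K ⧸ N) = q)
    (m : M) (q : K ⧸ N) (f : Monoid.Coprod N (Monoid.CoprodI fun _ : ι => M)) :
    cosetAction N e t ht (inr m) (q, f) =
      (q, inr (Monoid.CoprodI.of (i := e.symm q) m) * f) := rfl

theorem cosetAction_mul (e : ι ≃ K ⧸ N) (t : K ⧸ N → K) (ht : ∀ q, (t q : K ⧸ N) = q)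
    (g h : Monoid.Coprod K M)
    (p : (K ⧸ N) × Monoid.Coprod N (Monoid.CoprodI fun _ : ι => M)) :
    cosetAction N e t ht (g * h) p = cosetAction N e t ht g (cosetAction N e t ht h p) := by
  rw [map_mul]
  rfl

theorem cosetAction_conjLift (e : ι ≃ K ⧸ N) (t : K ⧸ N → K) (ht : ∀ q, (t q : K ⧸ N) = q)
    (h1 : t (1 : K) = 1) (x f : Monoid.Coprod N (Monoid.CoprodI fun _ : ι => M)) :
    cosetAction N e t ht (conjLift N (fun i => t (e i)) x) (((1 : K) : K ⧸ N), f) =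
      (((1 : K) : K ⧸ N), x * f) := by
  induction x using induction_on_inl_of generalizing f with
  | one => simp [Function.End.one_def]
  | inl_mem n =>
    have hn : (n : K) • ((1 : K) : K ⧸ N) = ((1 : K) : K ⧸ N) := by
      rw [MulAction.Quotient.smul_coe, smul_eq_mul, mul_one, QuotientGroup.eq]
      simp
    have hc : cocycle N t ht n (1 : K) = n := by
      ext
      simp [cocycle, hn, h1]
    rw [conjLift_inl, cosetAction_inl, hn, hc]
  | of_mem i m =>
    have hq : t (e i) • ((1 : K) : K ⧸ N) = e i := by
      rw [MulAction.Quotient.smul_coe, smul_eq_mul, mul_one, ht]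
    have hq' : (t (e i))⁻¹ • e i = ((1 : K) : K ⧸ N) := by
      rw [inv_smul_eq_iff, hq]
    have hc : cocycle N t ht (t (e i)) (1 : K) = 1 := by
      ext
      simp [cocycle, hq, h1]
    have hc' : cocycle N t ht (t (e i))⁻¹ (e i) = 1 := by
      ext
      simp [cocycle, hq', h1]
    rw [conjLift_inr_of, ← map_inv, cosetAction_mul, cosetAction_mul, cosetAction_inl _ _ _ _ (t (e i)), hq, hc,
      cosetAction_inr, cosetAction_inl, hq', hc']
    simp
  | mul x y hx hy =>
    rw [map_mul, cosetAction_mul, hy, hx, mul_assoc]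

theorem conjLift_injective (e : ι ≃ K ⧸ N) (t : K ⧸ N → K) (ht : ∀ q, (t q : K ⧸ N) = q)
    (h1 : t (1 : K) = 1) : Injective (conjLift (M := M) N fun i => t (e i)) := by
  rw [injective_iff_map_eq_one]
  intro x hx
  have h := cosetAction_conjLift N e t ht h1 x 1
  rw [hx, map_one, mul_one] at h
  exact (congrArg Prod.snd h).symm

theorem inr_mem_range_conjLift (e : ι ≃ K ⧸ N) (t : K ⧸ N → K) (h1 : t (1 : K) = 1) (m : M) :
    inr m ∈ (conjLift (M := M) N fun i => t (e i)).range :=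
  ⟨inr (Monoid.CoprodI.of (i := e.symm (1 : K)) m), by simp [h1]⟩

theorem normal_range_conjLift [N.Normal] (e : ι ≃ K ⧸ N) (t : K ⧸ N → K)
    (ht : ∀ q, (t q : K ⧸ N) = q) (h1 : t (1 : K) = 1) :
    (conjLift (M := M) N fun i => t (e i)).range.Normal := by
  set R := (conjLift (M := M) N fun i => t (e i)).range
  refine ⟨fun x hx g => ?_⟩
  induction g using Monoid.Coprod.induction_on generalizing x with
  | inl k =>
    obtain ⟨y, rfl⟩ := hx
    induction y using induction_on_inl_of with
    | one => simp
    | inl_mem n =>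
      exact ⟨inl ⟨k * n * k⁻¹, Subgroup.Normal.conj_mem ‹_› _ n.2 k⟩, by simp⟩
    | of_mem i m =>
      let q : K ⧸ N := ((t (e i) * k⁻¹ : K) : K ⧸ N)
      let n : N := ⟨(t q)⁻¹ * (t (e i) * k⁻¹), by rw [← QuotientGroup.eq, ht]⟩
      have hk : k = (n : K)⁻¹ * (t q)⁻¹ * t (e i) := by simp [n, mul_assoc]
      refine ⟨inl n⁻¹ * inr (Monoid.CoprodI.of (i := e.symm q) m) * inl n, ?_⟩
      rw [hk]
      simp [mul_assoc]
    | mul x y hx hy =>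
      rw [map_mul, ← conj_mul]
      exact R.mul_mem hx hy
  | inr m =>
    have hm := inr_mem_range_conjLift N e t h1 m
    exact R.mul_mem (R.mul_mem hm hx) (R.inv_mem hm)
  | mul g h hg hh =>
    have := hg _ (hh x hx)
    simpa [mul_assoc] using this

theorem range_conjLift [N.Normal] (e : ι ≃ K ⧸ N) (t : K ⧸ N → K)
    (ht : ∀ q, (t q : K ⧸ N) = q) (h1 : t (1 : K) = 1) :
    (conjLift (M := M) N fun i => t (e i)).range =
      Subgroup.normalClosure (((inl : K →* Monoid.Coprod K M) '' (N : Set K)) ∪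
        Set.range (inr : M →* Monoid.Coprod K M)) := by
  apply le_antisymm
  · rintro _ ⟨x, rfl⟩
    induction x using induction_on_inl_of with
    | one => simp
    | inl_mem n => exact Subgroup.subset_normalClosure (Or.inl ⟨n, n.2, rfl⟩)
    | of_mem i m =>
      have h := Subgroup.normalClosure_normal.conj_mem _
        (Subgroup.subset_normalClosure (s := ((inl : K →* Monoid.Coprod K M) '' (N : Set K)) ∪
          Set.range (inr : M →* Monoid.Coprod K M)) (Or.inr ⟨m, rfl⟩)) (inl (t (e i)))⁻¹
      simpa using h
    | mul x y hx hy =>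
      rw [map_mul]
      exact mul_mem hx hy
  · have := normal_range_conjLift (M := M) N e t ht h1
    apply Subgroup.normalClosure_le_normal
    rintro _ (⟨n, hn, rfl⟩ | ⟨m, rfl⟩)
    · exact ⟨inl ⟨n, hn⟩, rfl⟩
    · exact inr_mem_range_conjLift N e t h1 m

end Monoid.Coprod

theorem stmt14 {K M : Type*} [Group K] [Group M] (N : Subgroup K) [N.Normal]
    (r : ℕ) (hr : 0 < r) (hindex : N.index = r) :
    Nonempty
      ((Subgroup.normalClosure
          ((⇑(Monoid.Coprod.inl : K →* Monoid.Coprod K M) '' (N : Set K)) ∪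
            Set.range ⇑(Monoid.Coprod.inr : M →* Monoid.Coprod K M)) :
          Subgroup (Monoid.Coprod K M)) ≃*
        Monoid.Coprod ↥N (Monoid.CoprodI fun _ : Fin r => M)) := by
  classical
  have : Finite (K ⧸ N) := Nat.finite_of_card_ne_zero (by rw [← Subgroup.index]; omega)
  let e : Fin r ≃ K ⧸ N := (Finite.equivFinOfCardEq hindex).symm
  let t : K ⧸ N → K := Function.update Quotient.out ((1 : K) : K ⧸ N) 1
  have h1 : t (1 : K) = 1 := Function.update_self ..
  have ht : ∀ q, (t q : K ⧸ N) = q := fun q => by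
    by_cases hq : q = ((1 : K) : K ⧸ N)
    · rw [hq, h1]
    · simp only [t, Function.update_of_ne hq]
      exact QuotientGroup.out_eq' q
  exact ⟨(MulEquiv.subgroupCongr (Monoid.Coprod.range_conjLift N e t ht h1).symm).trans
    (MonoidHom.ofInjective (Monoid.Coprod.conjLift_injective N e t ht h1)).symm⟩
end

section
/- Let k be a finite field and r an integer. Let kˣ act on SL₂(k) by group automorphisms via ζ · [[x, y], [z, t]] = [[x, ζ^r·y], [ζ^{−r}·z, t]] (equivalently, conjugation by the diagonal matrix diag(ζ^r, 1) in GL₂(k)), and let E = SL₂(k) ⋊ kˣ be the corresponding semidirect product. Then E is isomorphic as a group to GL₂(k) if r is odd, and E is isomorphic as a group to SL₂(k) × kˣ if r is even. -/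
open Matrix

/-- A semidirect product `N ⋊[φ] G` is isomorphic to any group `H` that is an extension of `G` by `N`
split by `s`, provided conjugation by `s g` induces `φ g` on `N`. -/
theorem SemidirectProduct.nonempty_mulEquiv_of_split {N G H : Type*} [Group N] [Group G] [Group H]
    {φ : G →* MulAut N} (i : N →* H) (p : H →* G) (s : G →* H)
    (hi : Function.Injective i) (hker : p.ker = i.range) (hs : ∀ g, p (s g) = g)
    (hconj : ∀ g n, i (φ g n) * s g = s g * i n) :
    Nonempty (SemidirectProduct N G φ ≃* H) := by
  have hpi : ∀ n, p (i n) = 1 := fun n => by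
    rw [← MonoidHom.mem_ker, hker]
    exact ⟨n, rfl⟩
  let f : SemidirectProduct N G φ →* H := SemidirectProduct.lift i s fun g => by
    ext n
    simpa using eq_mul_inv_of_mul_eq (hconj g n)
  have hf : ∀ x, f x = i x.left * s x.right := fun _ => rfl
  refine ⟨MulEquiv.ofBijective f ⟨?_, ?_⟩⟩
  · rw [injective_iff_map_eq_one]
    intro x hx
    rw [hf] at hx
    have hr : x.right = 1 := by simpa [hpi, hs] using congrArg p hx
    have hl : x.left = 1 := hi (by simpa [hr] using hx)
    exact SemidirectProduct.ext hl hr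
  · intro h
    have hmem : h * (s (p h))⁻¹ ∈ p.ker := by simp [MonoidHom.mem_ker, hs]
    rw [hker] at hmem
    obtain ⟨n, hn⟩ := hmem
    exact ⟨⟨n, p h⟩, by simp [hf, hn]⟩

/-- The homomorphism `ζ ↦ diag(ζ ^ a, ζ ^ b)` into `GL₂`. -/
def Matrix.GeneralLinearGroup.diagZPow (k : Type*) [Field k] (a b : ℤ) :
    kˣ →* GeneralLinearGroup (Fin 2) k where
  toFun ζ := GeneralLinearGroup.mkOfDetNeZero
    !![((ζ ^ a : kˣ) : k), 0; 0, ((ζ ^ b : kˣ) : k)] (by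
      rw [det_fin_two_of, mul_zero, sub_zero, ← Units.val_mul]
      exact Units.ne_zero _)
  map_one' := by
    ext i j
    fin_cases i <;> fin_cases j <;> simp [GeneralLinearGroup.mkOfDetNeZero]
  map_mul' x y := by
    ext i j
    fin_cases i <;> fin_cases j <;> simp [GeneralLinearGroup.mkOfDetNeZero, mul_zpow]

/-- The homomorphism `ζ ↦ diag(ζ ^ a, ζ ^ (-a))` into `SL₂`. -/
def Matrix.SpecialLinearGroup.diagZPow (k : Type*) [Field k] (a : ℤ) :
    kˣ →* SpecialLinearGroup (Fin 2) k where
  toFun ζ := ⟨!![((ζ ^ a : kˣ) : k), 0; 0, ((ζ ^ (-a) : kˣ) : k)], by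
      rw [det_fin_two_of, mul_zero, sub_zero, ← Units.val_mul, ← _root_.zpow_add]
      simp⟩
  map_one' := by
    ext i j
    fin_cases i <;> fin_cases j <;> simp
  map_mul' x y := by
    refine Subtype.ext ?_
    change _ = !![((x ^ a : kˣ) : k), 0; 0, ((x ^ (-a) : kˣ) : k)] *
      !![((y ^ a : kˣ) : k), 0; 0, ((y ^ (-a) : kˣ) : k)]
    ext i j
    fin_cases i <;> fin_cases j <;> simp [mul_zpow, mul_comm]

/-- Conjugation by `diag(ζ ^ a, ζ ^ b)` scales the off-diagonal entries by `ζ ^ (a - b)` and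
`ζ ^ (b - a)`. -/
theorem Matrix.scale_offDiag_mul_diag {k : Type*} [Field k] (ζ : kˣ) {a b r : ℤ} (h : r = a - b)
    (A : Matrix (Fin 2) (Fin 2) k) :
    !![A 0 0, ((ζ ^ r : kˣ) : k) * A 0 1; ((ζ ^ (-r) : kˣ) : k) * A 1 0, A 1 1] *
        !![((ζ ^ a : kˣ) : k), 0; 0, ((ζ ^ b : kˣ) : k)] =
      !![((ζ ^ a : kˣ) : k), 0; 0, ((ζ ^ b : kˣ) : k)] * A := by
  have h₁ : ((ζ ^ r : kˣ) : k) * ((ζ ^ b : kˣ) : k) = ((ζ ^ a : kˣ) : k) := by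
    rw [← Units.val_mul, ← _root_.zpow_add, h, sub_add_cancel]
  have h₂ : ((ζ ^ (-r) : kˣ) : k) * ((ζ ^ a : kˣ) : k) = ((ζ ^ b : kˣ) : k) := by
    rw [← Units.val_mul, ← _root_.zpow_add, h, neg_sub, sub_add_cancel]
  ext i j
  fin_cases i <;> fin_cases j <;>
    simp only [mul_apply, Fin.sum_univ_two, of_apply, cons_val', cons_val_zero, cons_val_one,
      cons_val_fin_one, Fin.zero_eta, Fin.mk_one, mul_zero, zero_mul, add_zero, zero_add]
  · exact mul_comm _ _
  · rw [mul_right_comm, h₁]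
  · rw [mul_right_comm, h₂]
  · exact mul_comm _ _

theorem stmt16 (k : Type*) [Field k] [Fintype k] (r : ℤ)
    (φ : kˣ →* MulAut (Matrix.SpecialLinearGroup (Fin 2) k))
    (hφ : ∀ (ζ : kˣ) (A : Matrix.SpecialLinearGroup (Fin 2) k),
      ((φ ζ A : Matrix.SpecialLinearGroup (Fin 2) k) : Matrix (Fin 2) (Fin 2) k) =
        !![(A : Matrix (Fin 2) (Fin 2) k) 0 0,
            ((ζ ^ r : kˣ) : k) * (A : Matrix (Fin 2) (Fin 2) k) 0 1;
           ((ζ ^ (-r) : kˣ) : k) * (A : Matrix (Fin 2) (Fin 2) k) 1 0,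
            (A : Matrix (Fin 2) (Fin 2) k) 1 1]) :
    (Odd r → Nonempty (SemidirectProduct (Matrix.SpecialLinearGroup (Fin 2) k) kˣ φ ≃*
        Matrix.GeneralLinearGroup (Fin 2) k)) ∧
    (Even r → Nonempty (SemidirectProduct (Matrix.SpecialLinearGroup (Fin 2) k) kˣ φ ≃*
        Matrix.SpecialLinearGroup (Fin 2) k × kˣ)) := by
  constructor
  · rintro ⟨m, hm⟩
    refine SemidirectProduct.nonempty_mulEquiv_of_split SpecialLinearGroup.toGL
      GeneralLinearGroup.det (GeneralLinearGroup.diagZPow k (m + 1) (-m)) ?_ ?_ ?_ ?_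
    · exact SpecialLinearGroup.toGL_injective
    · ext g
      refine ⟨fun hg => ⟨⟨g, congrArg Units.val hg⟩, Units.ext rfl⟩, ?_⟩
      rintro ⟨A, rfl⟩
      exact Units.ext A.2
    · intro ζ
      ext
      change det !![((ζ ^ (m + 1) : kˣ) : k), 0; 0, ((ζ ^ (-m) : kˣ) : k)] = ζ
      rw [det_fin_two_of, mul_zero, sub_zero, ← Units.val_mul, ← _root_.zpow_add]
      simp
    · intro ζ A
      refine Units.ext ?_
      change ((φ ζ A : SpecialLinearGroup (Fin 2) k) : Matrix (Fin 2) (Fin 2) k) *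
        !![((ζ ^ (m + 1) : kˣ) : k), 0; 0, ((ζ ^ (-m) : kˣ) : k)] = _
      rw [hφ]
      exact scale_offDiag_mul_diag ζ (by omega) A.1
  · rintro ⟨m, hm⟩
    refine SemidirectProduct.nonempty_mulEquiv_of_split (MonoidHom.inl _ _) (MonoidHom.snd _ _)
      ((SpecialLinearGroup.diagZPow k m).prod (MonoidHom.id _)) ?_ ?_ (fun _ => rfl) ?_
    · exact fun A B h => congrArg Prod.fst h
    · ext ⟨A, ζ⟩
      simp [Subgroup.mem_prod, eq_comm]
    · intro ζ A
      refine Prod.ext (Subtype.ext ?_) (by simp)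
      change ((φ ζ A : SpecialLinearGroup (Fin 2) k) : Matrix (Fin 2) (Fin 2) k) *
        !![((ζ ^ m : kˣ) : k), 0; 0, ((ζ ^ (-m) : kˣ) : k)] = _
      rw [hφ]
      exact scale_offDiag_mul_diag ζ (by omega) A.1
end

section
/- Let p be an odd prime, m ≥ 3 an integer with p ≡ 1 (mod m), and θ ∈ 𝔽_pˣ an element of multiplicative order exactly m. Let D be the group of 𝔽_p-algebra automorphisms of the polynomial ring 𝔽_p[x, y] generated by the automorphism ω with ω(x) = y, ω(y) = x, and the automorphism τ with τ(x) = θ·x, τ(y) = θ^{−1}·y (D is a dihedral group of order 2m). Then the subalgebra of D-invariants 𝔽_p[x, y]^D equals the 𝔽_p-subalgebra of 𝔽_p[x, y] generated by the two polynomials x·y and x^m + y^m. -/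
open MvPolynomial

theorem Subalgebra.pow_add_pow_mem {R A : Type*} [CommRing R] [CommRing A] [Algebra R A]
    (S : Subalgebra R A) {u v : A} (hadd : u + v ∈ S) (hmul : u * v ∈ S) (k : ℕ) :
    u ^ k + v ^ k ∈ S := by
  induction k using Nat.twoStepInduction with
  | zero => simpa using S.add_mem S.one_mem S.one_mem
  | one => simpa using hadd
  | more k ih₀ ih₁ =>
    have h : u ^ (k + 2) + v ^ (k + 2) =
        (u + v) * (u ^ (k + 1) + v ^ (k + 1)) - u * v * (u ^ k + v ^ k) := by ring
    rw [h]
    exact S.sub_mem (S.mul_mem hadd ih₁) (S.mul_mem hmul ih₀)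

theorem Subalgebra.pow_mul_pow_add_mem_of_modEq {R A : Type*} [CommRing R] [CommRing A]
    [Algebra R A] (S : Subalgebra R A) {x y : A} {m a b : ℕ} (hmul : x * y ∈ S)
    (hadd : x ^ m + y ^ m ∈ S) (hab : a ≡ b [MOD m]) :
    x ^ a * y ^ b + y ^ a * x ^ b ∈ S := by
  wlog hle : b ≤ a generalizing a b
  · have h := this hab.symm (by omega)
    rwa [add_comm, mul_comm (y ^ b), mul_comm (x ^ b)] at h
  obtain ⟨k, hk⟩ := (Nat.modEq_iff_dvd' hle).1 hab.symm
  obtain rfl : a = b + m * k := by omega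
  have h : x ^ (b + m * k) * y ^ b + y ^ (b + m * k) * x ^ b =
      (x * y) ^ b * ((x ^ m) ^ k + (y ^ m) ^ k) := by ring
  rw [h]
  refine S.mul_mem (S.pow_mem hmul b) (S.pow_add_pow_mem hadd ?_ k)
  rw [← mul_pow]
  exact S.pow_mem hmul m

theorem MvPolynomial.coeff_algHom_of_diagonal {R : Type*} [CommRing R]
    (τ : MvPolynomial (Fin 2) R →ₐ[R] MvPolynomial (Fin 2) R) {s t : R}
    (h₀ : τ (X 0) = C s * X 0) (h₁ : τ (X 1) = C t * X 1)
    (f : MvPolynomial (Fin 2) R) (d : Fin 2 →₀ ℕ) :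
    coeff d (τ f) = s ^ d 0 * t ^ d 1 * coeff d f := by
  induction f using MvPolynomial.induction_on' with
  | monomial e c =>
    have h : τ (monomial e c) = C (s ^ e 0 * t ^ e 1) * monomial e c := by
      simp only [monomial_fin_two, map_mul, map_pow, h₀, h₁, algHom_C, algebraMap_eq]
      ring
    rw [h, coeff_C_mul, coeff_monomial]
    split_ifs with hed
    · rw [hed]
    · simp
  | add f g hf hg => rw [map_add, coeff_add, coeff_add, hf, hg]; ring

theorem MvPolynomial.mem_adjoin_of_invariant {K : Type*} [Field K] (h2 : (2 : K) ≠ 0) (θ : Kˣ)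
    (ω τ : MvPolynomial (Fin 2) K →ₐ[K] MvPolynomial (Fin 2) K)
    (hωx : ω (X 0) = X 1) (hωy : ω (X 1) = X 0)
    (hτx : τ (X 0) = C (θ : K) * X 0) (hτy : τ (X 1) = C ((θ : K)⁻¹) * X 1)
    {f : MvPolynomial (Fin 2) K} (hω : ω f = f) (hτ : τ f = f) :
    f ∈ Algebra.adjoin K
      {(X 0 * X 1 : MvPolynomial (Fin 2) K), X 0 ^ orderOf θ + X 1 ^ orderOf θ} := by
  set S := Algebra.adjoin K
    {(X 0 * X 1 : MvPolynomial (Fin 2) K), X 0 ^ orderOf θ + X 1 ^ orderOf θ}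
  have hmul : X 0 * X 1 ∈ S := Algebra.subset_adjoin (by simp)
  have hadd : X 0 ^ orderOf θ + X 1 ^ orderOf θ ∈ S := Algebra.subset_adjoin (by simp)
  have hsum : f + ω f ∈ S := by
    have h : f + ω f = ∑ d ∈ f.support,
        (monomial d (coeff d f) + ω (monomial d (coeff d f))) := by
      rw [Finset.sum_add_distrib, ← map_sum, ← f.as_sum]
    rw [h]
    refine S.sum_mem fun d hd => ?_
    have hmod : d 0 ≡ d 1 [MOD orderOf θ] := by
      rw [← pow_eq_pow_iff_modEq, ← Units.val_inj]
      have hc := coeff_algHom_of_diagonal τ hτx hτy f d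
      rw [hτ] at hc
      have h1 := (right_eq_mul₀ (mem_support_iff.1 hd)).1 hc
      rw [inv_pow, mul_inv_eq_one₀ (pow_ne_zero _ θ.ne_zero)] at h1
      simpa using h1
    have h' : monomial d (coeff d f) + ω (monomial d (coeff d f)) =
        coeff d f • (X 0 ^ d 0 * X 1 ^ d 1 + X 1 ^ d 0 * X 0 ^ d 1) := by
      simp only [monomial_fin_two, map_mul, map_pow, hωx, hωy, algHom_C, algebraMap_eq,
        smul_eq_C_mul]
      ring
    rw [h']
    exact S.smul_mem (S.pow_mul_pow_add_mem_of_modEq hmul hadd hmod) _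
  rw [hω, ← two_smul K] at hsum
  simpa [smul_smul, h2] using S.smul_mem hsum (2 : K)⁻¹

open MvPolynomial

theorem stmt18 (p : ℕ) [Fact p.Prime] (hp : Odd p) (m : ℕ) (hm : 3 ≤ m)
    (hpm : p % m = 1) (θ : (ZMod p)ˣ) (hθ : orderOf θ = m)
    (ω τ : MvPolynomial (Fin 2) (ZMod p) ≃ₐ[ZMod p] MvPolynomial (Fin 2) (ZMod p))
    (hωx : ω (X 0) = X 1) (hωy : ω (X 1) = X 0)
    (hτx : τ (X 0) = C (θ : ZMod p) * X 0)
    (hτy : τ (X 1) = C ((θ : ZMod p)⁻¹) * X 1)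
    (D : Subgroup (MvPolynomial (Fin 2) (ZMod p) ≃ₐ[ZMod p] MvPolynomial (Fin 2) (ZMod p)))
    (hD : D = Subgroup.closure {ω, τ}) :
    {f : MvPolynomial (Fin 2) (ZMod p) | ∀ g ∈ D, g f = f} =
      ↑(Algebra.adjoin (ZMod p)
          {(X 0 * X 1 : MvPolynomial (Fin 2) (ZMod p)), X 0 ^ m + X 1 ^ m}) := by
  have h2 : (2 : ZMod p) ≠ 0 := by
    apply Ring.two_ne_zero
    rw [ZMod.ringChar_zmod_n]
    rintro rfl
    exact absurd hp (by decide)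
  subst hθ hD
  ext f
  constructor
  · intro hf
    exact mem_adjoin_of_invariant h2 θ (ω : _ →ₐ[ZMod p] _) (τ : _ →ₐ[ZMod p] _)
      hωx hωy hτx hτy (hf ω (Subgroup.subset_closure (by simp)))
      (hf τ (Subgroup.subset_closure (by simp)))
  · intro hf g hg
    have hθC : C (θ : ZMod p) * C ((θ : ZMod p)⁻¹) =
        (1 : MvPolynomial (Fin 2) (ZMod p)) := by
      rw [← C_mul, mul_inv_cancel₀ θ.ne_zero, C_1]
    have hθm : (θ : ZMod p) ^ orderOf θ = 1 := by
      rw [← Units.val_pow_eq_pow_val, pow_orderOf_eq_one, Units.val_one]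
    induction hg using Subgroup.closure_induction with
    | mem g hg =>
      have hle : Algebra.adjoin (ZMod p)
          {(X 0 * X 1 : MvPolynomial (Fin 2) (ZMod p)), X 0 ^ orderOf θ + X 1 ^ orderOf θ} ≤
          AlgHom.equalizer (g : _ →ₐ[ZMod p] _) (AlgHom.id (ZMod p) _) := by
        rw [Algebra.adjoin_le_iff]
        rintro q (rfl | rfl) <;> rcases hg with rfl | rfl
        · simp [hωx, hωy, mul_comm]
        · change g (X 0 * X 1) = X 0 * X 1
          rw [map_mul, hτx, hτy]
          linear_combination (X 0 * X 1) * hθC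
        · simp [hωx, hωy, add_comm]
        · change g (X 0 ^ orderOf θ + X 1 ^ orderOf θ) = X 0 ^ orderOf θ + X 1 ^ orderOf θ
          rw [map_add, map_pow, map_pow, hτx, hτy, mul_pow, mul_pow, ← C_pow, ← C_pow, inv_pow,
            hθm, inv_one, C_1, one_mul, one_mul]
      exact hle hf
    | one => rfl
    | mul g h _ _ hg hh => rw [AlgEquiv.mul_apply, hh, hg]
    | inv g _ hg => exact (AlgEquiv.symm_apply_eq g).2 hg.symm
end
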